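/- arXiv:0903.5421 — 4 statements merged into one kernel-verified Lean document; each statement's English description precedes it below -/
import Mathlib

section
/- Let α, β, γ be real numbers with α ≠ 0 and γ > 0. Then the double Lebesgue integral I(α,β,γ) = ∫₀¹∫₀¹ |t^α − τ^α|^γ / |t − τ|^β dt dτ (taken with values in [0,∞]) is finite if and only if the following three inequalities all hold: αγ − β > −2, γ − β > −1, and αγ > −1. -/
open MeasureTheory Set

/-- On `(0,1)` the function `1 - s ^ a` is comparable to `1 - s`. -/
lemma exists_bounds_one_sub_rpow {a : ℝ} (ha : 0 < a) :
    ∃ m M : ℝ, 0 < m ∧ 0 < M ∧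
      ∀ s ∈ Ioo (0:ℝ) 1, m * (1 - s) ≤ 1 - s ^ a ∧ 1 - s ^ a ≤ M * (1 - s) := by
  rcases le_total 1 a with h | h
  · refine ⟨1, a, one_pos, ha, fun s hs => ?_⟩
    have h1 := one_add_mul_self_le_rpow_one_add (s := s - 1) (by linarith [hs.1]) h
    have h2 := Real.rpow_le_rpow_of_exponent_ge hs.1 hs.2.le h
    rw [add_sub_cancel] at h1
    rw [Real.rpow_one] at h2
    constructor <;> linarith
  · refine ⟨a, 1, ha, one_pos, fun s hs => ?_⟩
    have h1 := rpow_one_add_le_one_add_mul_self (s := s - 1) (by linarith [hs.1]) ha.le h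
    have h2 := Real.rpow_le_rpow_of_exponent_ge hs.1 hs.2.le h
    rw [add_sub_cancel] at h1
    rw [Real.rpow_one] at h2
    constructor <;> linarith

/-- On `(0,1)` the function `|s ^ α - 1|` is comparable to `s ^ min α 0 * (1 - s)`. -/
lemma exists_bounds_abs_rpow_sub_one {α : ℝ} (hα : α ≠ 0) :
    ∃ m M : ℝ, 0 < m ∧ 0 < M ∧ ∀ s ∈ Ioo (0:ℝ) 1,
      m * (s ^ min α 0 * (1 - s)) ≤ |s ^ α - 1| ∧
        |s ^ α - 1| ≤ M * (s ^ min α 0 * (1 - s)) := by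
  rcases hα.lt_or_gt with h | h
  · obtain ⟨m, M, hm, hM, hb⟩ := exists_bounds_one_sub_rpow (neg_pos.2 h)
    refine ⟨m, M, hm, hM, fun s hs => ?_⟩
    have hp : 0 < s ^ α := Real.rpow_pos_of_pos hs.1 _
    have h1 : 1 ≤ s ^ α := Real.one_le_rpow_of_pos_of_le_one_of_nonpos hs.1 hs.2.le h.le
    have h2 : s ^ α - 1 = s ^ α * (1 - s ^ (-α)) := by
      rw [mul_sub, ← Real.rpow_add hs.1]; simp
    rw [min_eq_left h.le, abs_of_nonneg (by linarith), h2, mul_left_comm, mul_left_comm M]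
    exact ⟨mul_le_mul_of_nonneg_left (hb s hs).1 hp.le,
      mul_le_mul_of_nonneg_left (hb s hs).2 hp.le⟩
  · obtain ⟨m, M, hm, hM, hb⟩ := exists_bounds_one_sub_rpow h
    refine ⟨m, M, hm, hM, fun s hs => ?_⟩
    have h1 : s ^ α ≤ 1 := Real.rpow_le_one hs.1.le hs.2.le h.le
    rw [min_eq_right h.le, Real.rpow_zero, one_mul, abs_sub_comm,
      abs_of_nonneg (by linarith)]
    exact hb s hs

lemma integrableOn_Ioo_half_rpow_mul_one_sub_rpow_iff {q r : ℝ} :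
    IntegrableOn (fun s : ℝ => s ^ q * (1 - s) ^ r) (Ioo 0 (1 / 2)) ↔ -1 < q := by
  have hc : ∀ r : ℝ, ContinuousOn (fun s : ℝ => (1 - s) ^ r) (Icc 0 (1 / 2)) := fun r =>
    (continuousOn_const.sub continuousOn_id).rpow_const fun s hs => by
      left; have := hs.2; exact (by linarith : (0:ℝ) < 1 - s).ne'
  rw [← intervalIntegral.integrableOn_Ioo_rpow_iff (s := q) (t := 1 / 2) (by norm_num)]
  constructor
  · intro h
    refine (h.mul_continuousOn_of_subset (hc (-r)) measurableSet_Ioo isCompact_Icc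
      Ioo_subset_Icc_self).congr_fun (fun s hs => ?_) measurableSet_Ioo
    have h1 : 0 < 1 - s := by linarith [hs.2]
    simp only [mul_assoc, ← Real.rpow_add h1, add_neg_cancel, Real.rpow_zero, mul_one]
  · intro h
    exact h.mul_continuousOn_of_subset (hc r) measurableSet_Ioo isCompact_Icc
      Ioo_subset_Icc_self

lemma integrableOn_Ioo_rpow_mul_one_sub_rpow_iff {q r : ℝ} :
    IntegrableOn (fun s : ℝ => s ^ q * (1 - s) ^ r) (Ioo 0 1) ↔ -1 < q ∧ -1 < r := by
  have hr : IntegrableOn (fun s : ℝ => s ^ q * (1 - s) ^ r) (Ioo (1 / 2) 1) ↔ -1 < r := by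
    rw [← integrableOn_Ioo_half_rpow_mul_one_sub_rpow_iff (q := r) (r := q),
      ← (Measure.measurePreserving_sub_left volume (1:ℝ)).integrableOn_comp_preimage
        (Homeomorph.subLeft (1:ℝ)).measurableEmbedding]
    norm_num [Function.comp_def, mul_comm]
  have hu : Ioo (0:ℝ) 1 =ᵐ[volume] (Ioo 0 (1 / 2) ∪ Ioo (1 / 2) 1 : Set ℝ) := by
    have : Ioo (0:ℝ) 1 = Ioo 0 (1 / 2) ∪ Ico (1 / 2) 1 :=
      (Ioo_union_Ico_eq_Ioo (by norm_num) (by norm_num)).symm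
    rw [this]
    exact (ae_eq_refl _).union Ioo_ae_eq_Ico.symm
  rw [integrableOn_congr_set_ae hu, integrableOn_union, hr,
    integrableOn_Ioo_half_rpow_mul_one_sub_rpow_iff]

lemma integrableOn_Ioo_abs_rpow_sub_one_rpow_div_iff {α β γ : ℝ} (hα : α ≠ 0) (hγ : 0 < γ) :
    IntegrableOn (fun s : ℝ => |s ^ α - 1| ^ γ / |s - 1| ^ β) (Ioo 0 1) ↔
      -1 < α * γ ∧ -1 < γ - β := by
  have hq : -1 < α * γ ↔ -1 < min α 0 * γ := by
    rcases hα.lt_or_gt with h | h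
    · rw [min_eq_left h.le]
    · rw [min_eq_right h.le]
      have := mul_pos h hγ
      constructor <;> intro <;> linarith
  obtain ⟨m, M, hm, hM, hb⟩ := exists_bounds_abs_rpow_sub_one hα
  have key : ∀ s ∈ Ioo (0:ℝ) 1, s ^ (min α 0 * γ) * (1 - s) ^ (γ - β) =
      (s ^ min α 0 * (1 - s)) ^ γ / |s - 1| ^ β := fun s hs => by
    have h1 : 0 < 1 - s := by linarith [hs.2]
    rw [abs_sub_comm, abs_of_pos h1, Real.mul_rpow (Real.rpow_nonneg hs.1.le _) h1.le,
      ← Real.rpow_mul hs.1.le, Real.rpow_sub h1, mul_div_assoc]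
  have hpos : ∀ s ∈ Ioo (0:ℝ) 1, 0 ≤ s ^ min α 0 * (1 - s) := fun s hs =>
    mul_nonneg (Real.rpow_nonneg hs.1.le _) (by linarith [hs.2])
  rw [hq, ← integrableOn_Ioo_rpow_mul_one_sub_rpow_iff]
  constructor
  · intro h
    refine Integrable.mono' (h.const_mul (m ^ γ)⁻¹)
      (by fun_prop : Measurable _).aestronglyMeasurable ?_
    refine (ae_restrict_iff' measurableSet_Ioo).2 (.of_forall fun s hs => ?_)
    have hmγ : 0 < m ^ γ := Real.rpow_pos_of_pos hm _
    have h0 := hpos s hs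
    rw [key s hs, Real.norm_of_nonneg (by positivity), inv_mul_eq_div, le_div_iff₀ hmγ,
      mul_comm, ← mul_div_assoc, ← Real.mul_rpow hm.le h0]
    gcongr
    exact (hb s hs).1
  · intro h
    refine Integrable.mono' (h.const_mul (M ^ γ))
      (by fun_prop : Measurable _).aestronglyMeasurable ?_
    refine (ae_restrict_iff' measurableSet_Ioo).2 (.of_forall fun s hs => ?_)
    have h0 := hpos s hs
    rw [key s hs, Real.norm_of_nonneg (by positivity), ← mul_div_assoc,
      ← Real.mul_rpow hM.le h0]
    gcongr
    exact (hb s hs).2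

/-- A nonnegative symmetric kernel vanishing on the diagonal integrates over a square to twice
its integral over the lower triangle. -/
lemma lintegral_lintegral_Ioo_eq_two_mul_of_symm {f : ℝ → ℝ → ENNReal}
    (hf : Measurable (Function.uncurry f)) (hsymm : ∀ x y, f x y = f y x)
    (hdiag : ∀ x, f x x = 0) (a b : ℝ) :
    ∫⁻ y in Ioo a b, ∫⁻ x in Ioo a b, f x y = 2 * ∫⁻ y in Ioo a b, ∫⁻ x in Ioo a y, f x y := by
  let g : ℝ → ℝ → ENNReal := fun y x => if x < y then f x y else 0
  have hg : Measurable (Function.uncurry g) :=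
    Measurable.ite (measurableSet_lt measurable_snd measurable_fst)
      (hf.comp measurable_swap) measurable_const
  have hg' : Measurable (Function.uncurry fun y x => g x y) := hg.comp measurable_swap
  have hsplit : ∀ y x, f x y = g y x + g x y := fun y x => by
    rcases lt_trichotomy x y with h | rfl | h
    · simp [g, h, h.not_gt]
    · simp [g, hdiag]
    · simp [g, h, h.not_gt, hsymm x y]
  have htri : ∀ y ∈ Ioo a b, ∫⁻ x in Ioo a b, g y x = ∫⁻ x in Ioo a y, f x y := fun y hy => by
    have : (fun x => g y x) = (Iio y).indicator fun x => f x y := by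
      ext x; simp [g, indicator]
    rw [this, setLIntegral_indicator measurableSet_Iio, Iio_inter_Ioo, min_eq_left hy.2.le]
  rw [← setLIntegral_congr_fun measurableSet_Ioo htri]
  simp only [hsplit]
  have hinner : ∀ y, ∫⁻ x in Ioo a b, (g y x + g x y) =
      (∫⁻ x in Ioo a b, g y x) + ∫⁻ x in Ioo a b, g x y := fun y =>
    lintegral_add_left (hg.comp measurable_prodMk_left) _
  simp only [hinner]
  rw [lintegral_add_left (f := fun y => ∫⁻ x in Ioo a b, g y x) hg.lintegral_prod_right',
    lintegral_lintegral_swap (f := fun y x => g x y) hg'.aemeasurable, two_mul]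

lemma setLIntegral_Ioo_zero_eq_mul_comp_mul (f : ℝ → ENNReal) {c : ℝ} (hc : 0 < c) :
    ∫⁻ t in Ioo 0 c, f t = ENNReal.ofReal c * ∫⁻ s in Ioo 0 1, f (c * s) := by
  have himg : (fun s => c * s) '' Ioo 0 1 = Ioo 0 c := by
    simpa using image_mul_left_Ioo hc 0 1
  rw [← himg, lintegral_image_eq_lintegral_abs_deriv_mul measurableSet_Ioo (f' := fun _ => c)
    (fun s _ => by simpa using ((hasDerivAt_id s).const_mul c).hasDerivWithinAt)
    (mul_right_injective₀ hc.ne').injOn, abs_of_pos hc,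
    lintegral_const_mul' _ _ ENNReal.ofReal_ne_top]

lemma setLIntegral_ofReal_lt_top_iff {f : ℝ → ℝ} {S : Set ℝ} (hS : MeasurableSet S)
    (hf : Measurable f) (h0 : ∀ x ∈ S, 0 ≤ f x) :
    ∫⁻ x in S, ENNReal.ofReal (f x) < ⊤ ↔ IntegrableOn f S := by
  rw [lt_top_iff_ne_top]
  exact lintegral_ofReal_ne_top_iff_integrable hf.aestronglyMeasurable
    ((ae_restrict_iff' hS).2 (.of_forall h0))

lemma setLIntegral_Ioo_zero_one_ofReal_ne_zero {f : ℝ → ℝ} (hf : Measurable f)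
    (hpos : ∀ x ∈ Ioo (0:ℝ) 1, 0 < f x) :
    ∫⁻ x in Ioo (0:ℝ) 1, ENNReal.ofReal (f x) ≠ 0 := by
  refine (setLIntegral_pos_iff hf.ennreal_ofReal |>.2 ?_).ne'
  rw [inter_eq_right.2 fun x hx => by simpa using hpos x hx]
  simp

/-- Lemma A of the appendix: the double integral
`I(α,β,γ) = ∫₀¹∫₀¹ |t^α − τ^α|^γ / |t − τ|^β dt dτ` (in `[0,∞]`) is finite
iff `αγ − β > −2`, `γ − β > −1` and `αγ > −1`. -/
theorem lemmaA (α β γ : ℝ) (hα : α ≠ 0) (hγ : 0 < γ) :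
    (∫⁻ τ in Ioo (0:ℝ) 1, ∫⁻ t in Ioo (0:ℝ) 1,
        ENNReal.ofReal (|t ^ α - τ ^ α| ^ γ / |t - τ| ^ β)) < ⊤ ↔
      (α * γ - β > -2 ∧ γ - β > -1 ∧ α * γ > -1) := by
  rw [lintegral_lintegral_Ioo_eq_two_mul_of_symm
    (f := fun t τ => ENNReal.ofReal (|t ^ α - τ ^ α| ^ γ / |t - τ| ^ β))
    (by unfold Function.uncurry; fun_prop)
    (fun t τ => by rw [abs_sub_comm (t ^ α), abs_sub_comm t])
    (fun t => by simp [Real.zero_rpow hγ.ne'])]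
  have hscale : ∀ τ ∈ Ioo (0:ℝ) 1,
      ∫⁻ t in Ioo 0 τ, ENNReal.ofReal (|t ^ α - τ ^ α| ^ γ / |t - τ| ^ β) =
        ENNReal.ofReal (τ ^ (α * γ - β + 1)) *
          ∫⁻ s in Ioo 0 1, ENNReal.ofReal (|s ^ α - 1| ^ γ / |s - 1| ^ β) := fun τ hτ => by
    have h0 := hτ.1
    rw [setLIntegral_Ioo_zero_eq_mul_comp_mul _ h0, Real.rpow_add_one h0.ne',
      mul_comm (τ ^ _), ENNReal.ofReal_mul h0.le, mul_assoc]
    congr 1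
    rw [← lintegral_const_mul' _ _ ENNReal.ofReal_ne_top]
    refine setLIntegral_congr_fun measurableSet_Ioo fun s hs => ?_
    have h1 : (τ * s) ^ α - τ ^ α = τ ^ α * (s ^ α - 1) := by
      rw [Real.mul_rpow h0.le hs.1.le]; ring
    have h2 : τ * s - τ = τ * (s - 1) := by ring
    have h3 : 0 < τ ^ α := Real.rpow_pos_of_pos h0 _
    rw [← ENNReal.ofReal_mul (Real.rpow_nonneg h0.le _), h1, h2, abs_mul, abs_mul,
      abs_of_pos h3, abs_of_pos h0, Real.mul_rpow h3.le (abs_nonneg _),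
      Real.mul_rpow h0.le (abs_nonneg _), ← Real.rpow_mul h0.le, Real.rpow_sub h0,
      mul_div_mul_comm]
  rw [setLIntegral_congr_fun measurableSet_Ioo hscale, lintegral_mul_const _ (by fun_prop : Measurable _)]
  have hA := setLIntegral_Ioo_zero_one_ofReal_ne_zero
    (f := fun τ : ℝ => τ ^ (α * γ - β + 1)) (by fun_prop)
    fun τ hτ => Real.rpow_pos_of_pos hτ.1 _
  have hJ := setLIntegral_Ioo_zero_one_ofReal_ne_zero
    (f := fun s : ℝ => |s ^ α - 1| ^ γ / |s - 1| ^ β) (by fun_prop) fun s hs => by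
      have h1 : s ^ α - 1 ≠ 0 := by
        rw [sub_ne_zero, ← Real.one_rpow α, Ne, Real.rpow_left_inj hs.1.le zero_le_one hα]
        exact hs.2.ne
      have h2 : s - 1 ≠ 0 := sub_ne_zero.2 hs.2.ne
      positivity
  have hA' := setLIntegral_ofReal_lt_top_iff (f := fun τ : ℝ => τ ^ (α * γ - β + 1))
    measurableSet_Ioo (by fun_prop) fun τ (hτ : τ ∈ Ioo (0:ℝ) 1) => Real.rpow_nonneg hτ.1.le _
  have hJ' := setLIntegral_ofReal_lt_top_iff (f := fun s : ℝ => |s ^ α - 1| ^ γ / |s - 1| ^ β)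
    measurableSet_Ioo (by fun_prop) fun s (_ : s ∈ Ioo (0:ℝ) 1) => by positivity
  rw [intervalIntegral.integrableOn_Ioo_rpow_iff one_pos] at hA'
  rw [integrableOn_Ioo_abs_rpow_sub_one_rpow_div_iff hα hγ] at hJ'
  simp only [ENNReal.mul_lt_top_iff, hA, hJ, hA', hJ', ENNReal.ofNat_lt_top, mul_eq_zero,
    OfNat.ofNat_ne_zero, or_false, true_and]
  constructor
  · rintro ⟨h1, h2, h3⟩
    exact ⟨by linarith, h3, h2⟩
  · rintro ⟨h1, h2, h3⟩
    exact ⟨by linarith, h3, h2⟩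
end

section
/- Let α, β, γ be real numbers with α ≠ 0 and γ > 0. Then the Lebesgue integral ∫₀¹ |1 − λ^α|^γ / (1 − λ)^β dλ (taken with values in [0,∞]) is finite if and only if both αγ > −1 and γ − β > −1. -/
open MeasureTheory Set

/-- On `(0, 1/2)` the factor `(1 - x) ^ b` does not affect integrability. -/
lemma intervalIntegrable_rpow_mul_one_sub_rpow_half_iff (a b : ℝ) :
    IntervalIntegrable (fun x : ℝ => x ^ a * (1 - x) ^ b) volume 0 (1 / 2) ↔ -1 < a := by
  have hcont : ∀ c : ℝ, ContinuousOn (fun x : ℝ => (1 - x) ^ c) (uIcc 0 (1 / 2)) := by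
    intro c
    refine ContinuousOn.rpow_const (by fun_prop) fun x hx => Or.inl ?_
    rw [uIcc_of_le (by norm_num)] at hx
    linarith [hx.2]
  rw [← intervalIntegral.integrableOn_Ioo_rpow_iff (s := a) (t := 1 / 2) (by norm_num),
    ← intervalIntegrable_iff_integrableOn_Ioo_of_le (by norm_num)]
  refine ⟨fun h => ?_, fun h => h.mul_continuousOn (hcont b)⟩
  refine (h.mul_continuousOn (hcont (-b))).congr fun x hx => ?_
  rw [uIoc_of_le (by norm_num)] at hx
  have hx1 : 0 < 1 - x := by linarith [hx.2]
  simp only [mul_assoc, ← Real.rpow_add hx1, add_neg_cancel, Real.rpow_zero, mul_one]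

/-- Convergence criterion for the real beta integral. -/
lemma integrableOn_rpow_mul_one_sub_rpow_iff (a b : ℝ) :
    IntegrableOn (fun x : ℝ => x ^ a * (1 - x) ^ b) (Ioo 0 1) ↔ -1 < a ∧ -1 < b := by
  have hright : IntervalIntegrable (fun x : ℝ => x ^ a * (1 - x) ^ b) volume (1 / 2) 1 ↔
      -1 < b := by
    rw [← intervalIntegrable_rpow_mul_one_sub_rpow_half_iff b a]
    constructor
    · intro h
      have := (h.comp_sub_left 1).symm
      norm_num at this
      simpa [mul_comm] using this
    · intro h
      have := (h.comp_sub_left 1).symm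
      norm_num at this
      simpa [mul_comm] using this
  rw [← intervalIntegrable_iff_integrableOn_Ioo_of_le zero_le_one, ← hright,
    ← intervalIntegrable_rpow_mul_one_sub_rpow_half_iff a b]
  refine ⟨fun h => ⟨h.mono_set ?_, h.mono_set ?_⟩, fun h => h.1.trans h.2⟩
  · rw [uIcc_of_le (by norm_num), uIcc_of_le (by norm_num)]
    exact Icc_subset_Icc le_rfl (by norm_num)
  · rw [uIcc_of_le (by norm_num), uIcc_of_le (by norm_num)]
    exact Icc_subset_Icc (by norm_num) le_rfl

/-- For `p > 0`, `1 - x ^ p` is comparable to `1 - x` on `(0, 1)`. -/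
lemma one_sub_rpow_bounds {p x : ℝ} (hp : 0 < p) (hx0 : 0 < x) (hx1 : x < 1) :
    min 1 p * (1 - x) ≤ 1 - x ^ p ∧ 1 - x ^ p ≤ max 1 p * (1 - x) := by
  rcases le_total 1 p with h | h
  · rw [min_eq_left h, max_eq_right h]
    have h1 := one_add_mul_self_le_rpow_one_add (s := x - 1) (by linarith) h
    have h2 := Real.rpow_le_rpow_of_exponent_ge hx0 hx1.le h
    rw [Real.rpow_one] at h2
    rw [add_sub_cancel] at h1
    constructor <;> linarith
  · rw [min_eq_right h, max_eq_left h]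
    have h1 := rpow_one_add_le_one_add_mul_self (s := x - 1) (by linarith) hp.le h
    have h2 := Real.rpow_le_rpow_of_exponent_ge hx0 hx1.le h
    rw [Real.rpow_one] at h2
    rw [add_sub_cancel] at h1
    constructor <;> linarith

/-- For `p ≠ 0`, `|1 - x ^ p|` is comparable to `x ^ min p 0 * (1 - x)` on `(0, 1)`. -/
lemma abs_one_sub_rpow_bounds {p x : ℝ} (hp : p ≠ 0) (hx0 : 0 < x) (hx1 : x < 1) :
    min 1 |p| * (x ^ min p 0 * (1 - x)) ≤ |1 - x ^ p| ∧
      |1 - x ^ p| ≤ max 1 |p| * (x ^ min p 0 * (1 - x)) := by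
  rcases hp.lt_or_gt with h | h
  · obtain ⟨h1, h2⟩ := one_sub_rpow_bounds (neg_pos.2 h) hx0 hx1
    have hpos : 0 < x ^ p := Real.rpow_pos_of_pos hx0 p
    have hle : x ^ (-p) ≤ 1 := Real.rpow_le_one hx0.le hx1.le (by linarith)
    have hmul : x ^ p * x ^ (-p) = 1 := by
      rw [← Real.rpow_add hx0, add_neg_cancel, Real.rpow_zero]
    have heq : |1 - x ^ p| = x ^ p * (1 - x ^ (-p)) := by
      have hge : 0 ≤ x ^ p * (1 - x ^ (-p)) := mul_nonneg hpos.le (by linarith)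
      rw [abs_sub_comm, abs_of_nonneg] <;> linarith
    rw [heq, abs_of_neg h, min_eq_left h.le, mul_left_comm, mul_left_comm (max 1 (-p))]
    exact ⟨mul_le_mul_of_nonneg_left h1 hpos.le, mul_le_mul_of_nonneg_left h2 hpos.le⟩
  · have hle : x ^ p ≤ 1 := Real.rpow_le_one hx0.le hx1.le h.le
    rw [abs_of_pos h, min_eq_right h.le, Real.rpow_zero, one_mul, abs_of_nonneg (by linarith)]
    exact one_sub_rpow_bounds h hx0 hx1

/-- One-variable integrability criterion from the proof of Lemma A:
`∫₀¹ |1 − λ^α|^γ / (1 − λ)^β dλ` (in `[0,∞]`) is finite iff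
`αγ > −1` and `γ − β > −1`. -/
theorem oneVarCriterion (α β γ : ℝ) (hα : α ≠ 0) (hγ : 0 < γ) :
    (∫⁻ l in Ioo (0:ℝ) 1,
        ENNReal.ofReal (|1 - l ^ α| ^ γ / (1 - l) ^ β)) < ⊤ ↔
      (α * γ > -1 ∧ γ - β > -1) := by
  set f : ℝ → ℝ := fun l => |1 - l ^ α| ^ γ / (1 - l) ^ β
  set g : ℝ → ℝ := fun l => l ^ (min α 0 * γ) * (1 - l) ^ (γ - β)
  have hfm : Measurable f := by fun_prop
  have hgm : Measurable g := by fun_prop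
  have hf0 : ∀ l ∈ Ioo (0 : ℝ) 1, 0 ≤ f l := fun l hl =>
    div_nonneg (Real.rpow_nonneg (abs_nonneg _) _) (Real.rpow_nonneg (by linarith [hl.2]) _)
  have hg0 : ∀ l ∈ Ioo (0 : ℝ) 1, 0 ≤ g l := fun l hl =>
    mul_nonneg (Real.rpow_nonneg hl.1.le _) (Real.rpow_nonneg (by linarith [hl.2]) _)
  have hc : 0 < min 1 |α| := lt_min one_pos (abs_pos.2 hα)
  have hC : 0 < max 1 |α| := lt_max_of_lt_left one_pos
  have hgeq : ∀ c : ℝ, 0 < c → ∀ l ∈ Ioo (0 : ℝ) 1,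
      (c * (l ^ min α 0 * (1 - l))) ^ γ / (1 - l) ^ β = c ^ γ * g l := by
    intro c hc l hl
    have hl1 : 0 < 1 - l := by linarith [hl.2]
    have hlm : 0 ≤ l ^ min α 0 := Real.rpow_nonneg hl.1.le _
    rw [Real.mul_rpow hc.le (mul_nonneg hlm hl1.le), Real.mul_rpow hlm hl1.le,
      ← Real.rpow_mul hl.1.le, mul_div_assoc, mul_div_assoc, ← Real.rpow_sub hl1]
  have hlow : ∀ l ∈ Ioo (0 : ℝ) 1, min 1 |α| ^ γ * g l ≤ f l := by
    intro l hl
    have hl1 : 0 < 1 - l := by linarith [hl.2]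
    have hlm : 0 ≤ l ^ min α 0 := Real.rpow_nonneg hl.1.le _
    rw [← hgeq _ hc l hl]
    exact div_le_div_of_nonneg_right (Real.rpow_le_rpow (by positivity)
      (abs_one_sub_rpow_bounds hα hl.1 hl.2).1 hγ.le) (by positivity)
  have hupp : ∀ l ∈ Ioo (0 : ℝ) 1, f l ≤ max 1 |α| ^ γ * g l := by
    intro l hl
    have hl1 : 0 < 1 - l := by linarith [hl.2]
    rw [← hgeq _ hC l hl]
    exact div_le_div_of_nonneg_right (Real.rpow_le_rpow (abs_nonneg _)
      (abs_one_sub_rpow_bounds hα hl.1 hl.2).2 hγ.le) (by positivity)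
  have hfin : (∫⁻ l in Ioo (0:ℝ) 1, ENNReal.ofReal (f l)) < ⊤ ↔ IntegrableOn f (Ioo 0 1) := by
    rw [← hasFiniteIntegral_iff_ofReal
      ((ae_restrict_iff' measurableSet_Ioo).2 (.of_forall hf0))]
    exact ⟨fun h => ⟨hfm.aestronglyMeasurable, h⟩, fun h => h.2⟩
  have hfg : IntegrableOn f (Ioo 0 1) ↔ IntegrableOn g (Ioo 0 1) := by
    constructor
    · intro h
      refine (h.const_mul (min 1 |α| ^ γ)⁻¹).mono' hgm.aestronglyMeasurable
        ((ae_restrict_iff' measurableSet_Ioo).2 (.of_forall fun l hl => ?_))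
      rw [Real.norm_of_nonneg (hg0 l hl), le_inv_mul_iff₀ (Real.rpow_pos_of_pos hc _)]
      exact hlow l hl
    · intro h
      refine (h.const_mul (max 1 |α| ^ γ)).mono' hfm.aestronglyMeasurable
        ((ae_restrict_iff' measurableSet_Ioo).2 (.of_forall fun l hl => ?_))
      rw [Real.norm_of_nonneg (hf0 l hl)]
      exact hupp l hl
  have hexp : -1 < min α 0 * γ ↔ α * γ > -1 := by
    rcases le_total α 0 with h | h
    · rw [min_eq_left h]
    · rw [min_eq_right h, zero_mul]
      have := mul_nonneg h hγ.le
      constructor <;> intro _ <;> linarith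
  rw [hfin, hfg, integrableOn_rpow_mul_one_sub_rpow_iff, hexp]
end

section
/- Let α, β, γ be real numbers with α ≠ 0 and γ > 0. Then the following identity holds in the extended nonnegative reals [0,∞]: ∫₀¹∫₀¹ |t^α − τ^α|^γ / |t − τ|^β dτ dt = 2 · (∫₀¹ t^{αγ−β+1} dt) · (∫₀¹ |1 − λ^α|^γ / (1 − λ)^β dλ), where both sides are Lebesgue integrals of nonnegative measurable functions. -/
open MeasureTheory Set

/-- The double integral of a symmetric function over the open unit square is twice its integral
over the triangle below the diagonal. -/
theorem lintegral_unitSquare_eq_two_mul_of_symm {F : ℝ × ℝ → ENNReal} (hF : Measurable F)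
    (hsymm : ∀ x y, F (x, y) = F (y, x)) :
    (∫⁻ t in Ioo (0:ℝ) 1, ∫⁻ τ in Ioo (0:ℝ) 1, F (t, τ)) =
      2 * ∫⁻ t in Ioo (0:ℝ) 1, ∫⁻ τ in Ioo (0:ℝ) t, F (t, τ) := by
  set G : ℝ × ℝ → ENNReal := {p : ℝ × ℝ | p.2 < p.1}.indicator F with hG
  have hGm : Measurable G := hF.indicator (measurableSet_lt measurable_snd measurable_fst)
  have hinner : ∀ t ∈ Ioo (0:ℝ) 1,
      ∫⁻ τ in Ioo (0:ℝ) 1, G (t, τ) = ∫⁻ τ in Ioo (0:ℝ) t, F (t, τ) := by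
    intro t ht
    have h : ∀ τ, G (t, τ) = (Iio t).indicator (fun τ => F (t, τ)) τ := fun _ => rfl
    simp_rw [h]
    rw [setLIntegral_indicator measurableSet_Iio]
    congr 2
    ext τ
    simp only [mem_inter_iff, mem_Iio, mem_Ioo]
    exact ⟨fun h => ⟨h.2.1, h.1⟩, fun h => ⟨h.2, h.1, h.2.trans ht.2⟩⟩
  have hsplit : ∀ t, ∫⁻ τ in Ioo (0:ℝ) 1, F (t, τ) =
      (∫⁻ τ in Ioo (0:ℝ) 1, G (t, τ)) + ∫⁻ τ in Ioo (0:ℝ) 1, G (τ, t) := by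
    intro t
    rw [← lintegral_add_left (f := fun τ => G (t, τ)) (hGm.comp measurable_prodMk_left)]
    refine lintegral_congr_ae (ae_restrict_of_ae ?_)
    filter_upwards [Measure.ae_ne volume t] with τ hτ
    rcases lt_or_gt_of_ne hτ with h | h
    · simp [hG, h, h.not_gt]
    · simp [hG, h, h.not_gt, hsymm t τ]
  simp_rw [hsplit]
  rw [lintegral_add_left hGm.lintegral_prod_right',
    lintegral_lintegral_swap (f := fun t τ => G (τ, t))
      (hGm.comp measurable_swap).aemeasurable, ← two_mul,
    setLIntegral_congr_fun measurableSet_Ioo hinner]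

/-- Rescaling an integral over `(0, t)` to the unit interval. -/
theorem setLIntegral_Ioo_zero_eq_mul_unitInterval {t : ℝ} (ht : 0 < t) (f : ℝ → ENNReal) :
    ∫⁻ τ in Ioo (0:ℝ) t, f τ = ∫⁻ l in Ioo (0:ℝ) 1, ENNReal.ofReal t * f (t * l) := by
  have himage : (fun l => t * l) '' Ioo (0:ℝ) 1 = Ioo 0 t := by
    rw [image_mul_left_Ioo ht, mul_zero, mul_one]
  rw [← himage, lintegral_image_eq_lintegral_abs_deriv_mul (f' := fun _ => t) measurableSet_Ioo
    (fun x _ => by simpa using ((hasDerivAt_id x).const_mul t).hasDerivWithinAt)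
    (mul_right_injective₀ ht.ne').injOn, abs_of_pos ht]

/-- The kernel `|t^α - τ^α|^γ / |t - τ|^β` is homogeneous of degree `αγ - β`. -/
theorem mul_rpow_kernel_comp_mul {α β γ t l : ℝ} (ht : 0 < t) (hl : l ∈ Ioo (0:ℝ) 1) :
    t * (|t ^ α - (t * l) ^ α| ^ γ / |t - t * l| ^ β) =
      t ^ (α * γ - β + 1) * (|1 - l ^ α| ^ γ / (1 - l) ^ β) := by
  have h1 : 0 < 1 - l := sub_pos.2 hl.2
  rw [Real.mul_rpow ht.le hl.1.le, show t ^ α - t ^ α * l ^ α = t ^ α * (1 - l ^ α) by ring,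
    show t - t * l = t * (1 - l) by ring, abs_mul, abs_of_pos (mul_pos ht h1),
    abs_of_pos (Real.rpow_pos_of_pos ht α),
    Real.mul_rpow (Real.rpow_nonneg ht.le α) (abs_nonneg _), Real.mul_rpow ht.le h1.le,
    ← Real.rpow_mul ht.le, Real.rpow_add ht, Real.rpow_sub ht, Real.rpow_one]
  ring

/-- Factorization of the double integral in the proof of Lemma A:
`∫₀¹∫₀¹ |t^α − τ^α|^γ / |t − τ|^β dτ dt
  = 2 · (∫₀¹ t^{αγ−β+1} dt) · (∫₀¹ |1 − λ^α|^γ / (1 − λ)^β dλ)` in `[0,∞]`. -/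
theorem doubleIntegralFactorization (α β γ : ℝ) (hα : α ≠ 0) (hγ : 0 < γ) :
    (∫⁻ t in Ioo (0:ℝ) 1, ∫⁻ τ in Ioo (0:ℝ) 1,
        ENNReal.ofReal (|t ^ α - τ ^ α| ^ γ / |t - τ| ^ β)) =
      2 * (∫⁻ t in Ioo (0:ℝ) 1, ENNReal.ofReal (t ^ (α * γ - β + 1))) *
        (∫⁻ l in Ioo (0:ℝ) 1,
          ENNReal.ofReal (|1 - l ^ α| ^ γ / (1 - l) ^ β)) := by
  rw [lintegral_unitSquare_eq_two_mul_of_symm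
    (F := fun p => ENNReal.ofReal (|p.1 ^ α - p.2 ^ α| ^ γ / |p.1 - p.2| ^ β)) (by fun_prop)
    (fun x y => by simp only [abs_sub_comm]), mul_assoc,
    ← lintegral_mul_const _ (by fun_prop)]
  congr 1
  refine setLIntegral_congr_fun measurableSet_Ioo fun t ht => ?_
  simp only
  rw [setLIntegral_Ioo_zero_eq_mul_unitInterval ht.1, ← lintegral_const_mul _ (by fun_prop)]
  refine setLIntegral_congr_fun measurableSet_Ioo fun l hl => ?_
  rw [← ENNReal.ofReal_mul ht.1.le, ← ENNReal.ofReal_mul (Real.rpow_nonneg ht.1.le _),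
    mul_rpow_kernel_comp_mul ht.1 hl]
end

section
/- Let m be a natural number, let θ be a real number with 0 < θ < 1, and let δ be a real number which is not an integer and satisfies δ > m + θ − 1/2. Then the double Lebesgue integral ∫₀¹∫₀¹ |t^{δ−m} − τ^{δ−m}|² / |t − τ|^{1+2θ} dt dτ (taken with values in [0,∞]) is finite. -/
open MeasureTheory Set

/-- The real Beta integrand is integrable on the open unit interval. -/
lemma integrableOn_rpow_mul_one_sub_rpow {a b : ℝ} (ha : -1 < a) (hb : -1 < b) :
    IntegrableOn (fun x : ℝ => x ^ a * (1 - x) ^ b) (Ioo 0 1) := by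
  have h := Complex.betaIntegral_convergent (u := ((a + 1 : ℝ) : ℂ)) (v := ((b + 1 : ℝ) : ℂ))
    (by rw [Complex.ofReal_re]; linarith) (by rw [Complex.ofReal_re]; linarith)
  rw [intervalIntegrable_iff_integrableOn_Ioo_of_le zero_le_one] at h
  refine IntegrableOn.congr_fun h.norm (fun x hx => ?_) measurableSet_Ioo
  have h1 : (0 : ℝ) < 1 - x := sub_pos.2 hx.2
  have h2 : (1 : ℂ) - (x : ℂ) = ((1 - x : ℝ) : ℂ) := by push_cast; ring
  simp only [norm_mul]
  rw [h2, Complex.norm_cpow_eq_rpow_re_of_pos hx.1, Complex.norm_cpow_eq_rpow_re_of_pos h1]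
  simp

lemma one_sub_rpow_le {s a : ℝ} (hs0 : 0 < s) (hs1 : s < 1) (ha : 0 ≤ a) :
    1 - s ^ a ≤ (1 + a) * (1 - s) := by
  rcases le_total a 1 with h | h
  · have : s ^ (1 : ℝ) ≤ s ^ a := Real.rpow_le_rpow_of_exponent_ge hs0 hs1.le h
    rw [Real.rpow_one] at this
    nlinarith [mul_nonneg ha (sub_nonneg.2 hs1.le)]
  · have := one_add_mul_self_le_rpow_one_add (s := s - 1) (by linarith) h
    rw [add_sub_cancel] at this
    nlinarith

lemma abs_rpow_sub_one_le {s : ℝ} (hs0 : 0 < s) (hs1 : s < 1) (a : ℝ) :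
    |s ^ a - 1| ≤ (1 + |a|) * (1 - s) * (1 + s ^ a) := by
  have hp : 0 < s ^ a := Real.rpow_pos_of_pos hs0 a
  have h1 : 0 < 1 - s := sub_pos.2 hs1
  rcases le_total 0 a with h | h
  · have := one_sub_rpow_le hs0 hs1 h
    have hle : s ^ a ≤ 1 := Real.rpow_le_one hs0.le hs1.le h
    rw [abs_of_nonpos (by linarith), abs_of_nonneg h]
    have : 0 ≤ (1 + a) * (1 - s) * s ^ a := by positivity
    linarith
  · have := one_sub_rpow_le hs0 hs1 (neg_nonneg.2 h)
    have hle : 1 ≤ s ^ a := Real.one_le_rpow_of_pos_of_le_one_of_nonpos hs0 hs1.le h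
    have hinv : s ^ a * s ^ (-a) = 1 := by
      rw [← Real.rpow_add hs0, add_neg_cancel, Real.rpow_zero]
    rw [abs_of_nonneg (by linarith), abs_of_nonpos h]
    have h2 := mul_le_mul_of_nonneg_left this hp.le
    have : 0 ≤ (1 + -a) * (1 - s) := mul_nonneg (by linarith) h1.le
    nlinarith

/-- The Slobodeckij quotient of `t ↦ t ^ a` with exponent `1 + 2 * θ`. -/
noncomputable def slobodeckijQuotient (a θ t τ : ℝ) : ℝ :=
  |t ^ a - τ ^ a| ^ (2 : ℝ) / |t - τ| ^ (1 + 2 * θ)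

lemma slobodeckijQuotient_comm (a θ t τ : ℝ) :
    slobodeckijQuotient a θ t τ = slobodeckijQuotient a θ τ t := by
  simp only [slobodeckijQuotient, abs_sub_comm]

lemma slobodeckijQuotient_self (a θ t : ℝ) : slobodeckijQuotient a θ t t = 0 := by
  simp [slobodeckijQuotient]

lemma measurable_slobodeckijQuotient (a θ : ℝ) :
    Measurable fun p : ℝ × ℝ => slobodeckijQuotient a θ p.1 p.2 := by
  unfold slobodeckijQuotient
  simp only [← Real.norm_eq_abs]
  fun_prop

lemma slobodeckijQuotient_mul_self {τ s : ℝ} (hτ : 0 < τ) (hs : 0 < s) (a θ : ℝ) :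
    τ * slobodeckijQuotient a θ (τ * s) τ =
      τ ^ (2 * a - 2 * θ) * slobodeckijQuotient a θ s 1 := by
  have hp : 0 < τ ^ a := Real.rpow_pos_of_pos hτ a
  have h1 : (τ * s) ^ a - τ ^ a = τ ^ a * (s ^ a - 1) := by
    rw [Real.mul_rpow hτ.le hs.le]; ring
  have h2 : τ * s - τ = τ * (s - 1) := by ring
  have h3 : τ ^ (2 * a - 2 * θ) = τ * (τ ^ a) ^ (2 : ℝ) / τ ^ (1 + 2 * θ) := by
    rw [← Real.rpow_mul hτ.le, show 2 * a - 2 * θ = 1 + a * 2 - (1 + 2 * θ) by ring,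
      Real.rpow_sub hτ, Real.rpow_add hτ, Real.rpow_one]
  rw [slobodeckijQuotient, slobodeckijQuotient, h1, h2, abs_mul, abs_mul, abs_of_pos hp,
    abs_of_pos hτ, Real.mul_rpow hp.le (abs_nonneg _), Real.mul_rpow hτ.le (abs_nonneg _),
    h3, Real.one_rpow]
  ring

lemma slobodeckijQuotient_one_le {s : ℝ} (hs0 : 0 < s) (hs1 : s < 1) (a θ : ℝ) :
    slobodeckijQuotient a θ s 1 ≤ 2 * (1 + |a|) ^ 2 *
      (s ^ (0 : ℝ) * (1 - s) ^ (1 - 2 * θ) + s ^ (2 * a) * (1 - s) ^ (1 - 2 * θ)) := by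
  have h1 : 0 < 1 - s := sub_pos.2 hs1
  have hq : 0 < (1 - s) ^ (1 + 2 * θ) := Real.rpow_pos_of_pos h1 _
  have hsq : (1 - s) ^ (1 - 2 * θ) * (1 - s) ^ (1 + 2 * θ) = (1 - s) ^ 2 := by
    rw [← Real.rpow_add h1, ← Real.rpow_natCast]
    norm_num
  have h2a : s ^ (2 * a) = (s ^ a) ^ 2 := by
    rw [mul_comm, Real.rpow_mul hs0.le, Real.rpow_two]
  rw [slobodeckijQuotient, Real.one_rpow, abs_sub_comm s 1, abs_of_pos h1, div_le_iff₀ hq,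
    Real.rpow_two, Real.rpow_zero, h2a]
  calc |s ^ a - 1| ^ 2 ≤ ((1 + |a|) * (1 - s) * (1 + s ^ a)) ^ 2 := by
        gcongr
        exact abs_rpow_sub_one_le hs0 hs1 a
    _ = (1 + |a|) ^ 2 * (1 - s) ^ 2 * (1 + s ^ a) ^ 2 := by ring
    _ ≤ (1 + |a|) ^ 2 * (1 - s) ^ 2 * (2 * (1 + (s ^ a) ^ 2)) := by
        gcongr
        nlinarith [sq_nonneg (1 - s ^ a)]
    _ = _ := by rw [← hsq]; ring

lemma setLIntegral_slobodeckijQuotient_one_lt_top {a θ : ℝ} (ha : -1 < 2 * a) (hθ : θ < 1) :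
    ∫⁻ s in Ioo (0 : ℝ) 1, ENNReal.ofReal (slobodeckijQuotient a θ s 1) < ⊤ := by
  have hint := ((integrableOn_rpow_mul_one_sub_rpow (a := 0) (b := 1 - 2 * θ) (by norm_num)
    (by linarith)).add (integrableOn_rpow_mul_one_sub_rpow (b := 1 - 2 * θ) ha
    (by linarith))).const_mul (2 * (1 + |a|) ^ 2)
  refine lt_of_le_of_lt ?_ (IntegrableOn.setLIntegral_lt_top hint)
  exact setLIntegral_mono' measurableSet_Ioo fun s hs =>
    ENNReal.ofReal_le_ofReal (slobodeckijQuotient_one_le hs.1 hs.2 a θ)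

lemma setLIntegral_slobodeckijQuotient_eq {τ : ℝ} (hτ : 0 < τ) (a θ : ℝ) :
    ∫⁻ t in Ioo 0 τ, ENNReal.ofReal (slobodeckijQuotient a θ t τ) =
      ENNReal.ofReal (τ ^ (2 * a - 2 * θ)) *
        ∫⁻ s in Ioo (0 : ℝ) 1, ENNReal.ofReal (slobodeckijQuotient a θ s 1) := by
  have himg : (fun s => τ * s) '' Ioo (0 : ℝ) 1 = Ioo 0 τ := by
    rw [Set.image_mul_left_Ioo hτ, mul_zero, mul_one]
  rw [← himg, lintegral_image_eq_lintegral_abs_deriv_mul measurableSet_Ioo (f' := fun _ => τ)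
    (fun x _ => by simpa using ((hasDerivAt_id x).const_mul τ).hasDerivWithinAt)
    (mul_right_injective₀ hτ.ne').injOn, ← lintegral_const_mul' _ _ ENNReal.ofReal_ne_top]
  refine setLIntegral_congr_fun measurableSet_Ioo fun s hs => ?_
  rw [abs_of_pos hτ, ← ENNReal.ofReal_mul hτ.le, slobodeckijQuotient_mul_self hτ hs.1,
    ENNReal.ofReal_mul (Real.rpow_nonneg hτ.le _)]

/-- A symmetric double integral is at most twice the integral below the diagonal, if the integrand
vanishes on the diagonal. -/
lemma lintegral_lintegral_le_two_mul_of_symm {μ : Measure ℝ} [SFinite μ]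
    {f : ℝ → ℝ → ENNReal} (hf : Measurable (Function.uncurry f))
    (hsymm : ∀ t τ, f t τ = f τ t) (hdiag : ∀ t, f t t = 0) :
    ∫⁻ τ, ∫⁻ t, f t τ ∂μ ∂μ ≤ 2 * ∫⁻ τ, ∫⁻ t, (Iio τ).indicator (fun t => f t τ) t ∂μ ∂μ := by
  set g : ℝ → ℝ → ENNReal := fun t τ => (Iio τ).indicator (fun t => f t τ) t with hg
  have hgm : Measurable (Function.uncurry g) :=
    hf.indicator (measurableSet_lt measurable_fst measurable_snd)
  have hsplit : ∀ t τ, f t τ = g t τ + g τ t := by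
    intro t τ
    rcases lt_trichotomy t τ with h | rfl | h
    · simp [hg, h, h.le]
    · simp [hg, hdiag]
    · simp [hg, h, h.le, hsymm t τ]
  have hswap : ∫⁻ τ, ∫⁻ t, g τ t ∂μ ∂μ = ∫⁻ τ, ∫⁻ t, g t τ ∂μ ∂μ :=
    lintegral_lintegral_swap hgm.aemeasurable
  have hgt : ∀ τ, Measurable fun t => g t τ := fun τ => hgm.comp measurable_prodMk_right
  have hgi : Measurable fun τ => ∫⁻ t, g t τ ∂μ := hgm.lintegral_prod_left'
  change _ ≤ 2 * ∫⁻ τ, ∫⁻ t, g t τ ∂μ ∂μ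
  rw [lintegral_congr fun τ => lintegral_congr fun t => hsplit t τ,
    lintegral_congr fun τ => lintegral_add_left (hgt τ) _, lintegral_add_left hgi, hswap, two_mul]

/-- Finiteness of the Slobodeckij-type double integral (6.1) from the proof of
Proposition A: for `m ∈ ℕ`, `0 < θ < 1`, `δ` non-integer with `δ > m + θ − 1/2`,
`∫₀¹∫₀¹ |t^{δ−m} − τ^{δ−m}|² / |t − τ|^{1+2θ} dt dτ < ∞`. -/
theorem slobodeckijFinite (m : ℕ) (θ δ : ℝ) (hθ0 : 0 < θ) (hθ1 : θ < 1)
    (hδ : ¬ ∃ n : ℤ, (n : ℝ) = δ) (hδm : δ > (m : ℝ) + θ - 1/2) :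
    (∫⁻ τ in Ioo (0:ℝ) 1, ∫⁻ t in Ioo (0:ℝ) 1,
        ENNReal.ofReal
          (|t ^ (δ - m) - τ ^ (δ - m)| ^ (2:ℝ) / |t - τ| ^ (1 + 2*θ))) < ⊤ := by
  set a : ℝ := δ - m with ha
  have hK := setLIntegral_slobodeckijQuotient_one_lt_top (a := a) (θ := θ) (by linarith) hθ1
  have hpow : ∫⁻ τ in Ioo (0 : ℝ) 1, ENNReal.ofReal (τ ^ (2 * a - 2 * θ)) < ⊤ :=
    ((intervalIntegral.integrableOn_Ioo_rpow_iff zero_lt_one).2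
      (by linarith)).setLIntegral_lt_top
  refine (lintegral_lintegral_le_two_mul_of_symm (μ := volume.restrict (Ioo (0 : ℝ) 1))
    (f := fun t τ => ENNReal.ofReal (slobodeckijQuotient a θ t τ))
    (measurable_slobodeckijQuotient a θ).ennreal_ofReal
    (fun t τ => by rw [slobodeckijQuotient_comm])
    (fun t => by rw [slobodeckijQuotient_self, ENNReal.ofReal_zero])).trans_lt
    (ENNReal.mul_lt_top (by simp) ?_)
  have hinner : ∀ τ ∈ Ioo (0 : ℝ) 1, ∫⁻ t in Ioo (0 : ℝ) 1,
      (Iio τ).indicator (fun t => ENNReal.ofReal (slobodeckijQuotient a θ t τ)) t =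
      ENNReal.ofReal (τ ^ (2 * a - 2 * θ)) *
        ∫⁻ s in Ioo (0 : ℝ) 1, ENNReal.ofReal (slobodeckijQuotient a θ s 1) := by
    intro τ hτ
    rw [lintegral_indicator measurableSet_Iio, Measure.restrict_restrict measurableSet_Iio,
      inter_comm, Ioo_inter_Iio, min_eq_right hτ.2.le, setLIntegral_slobodeckijQuotient_eq hτ.1]
  rw [setLIntegral_congr_fun measurableSet_Ioo hinner, lintegral_mul_const' _ _ hK.ne]
  exact ENNReal.mul_lt_top hpow hK
end
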